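/- arXiv:0704.2901 — 4 statements merged into one kernel-verified Lean document; each statement's English description precedes it below -/
import Mathlib

section
/- Let v₁, v₂, v₃, v₄ ∈ ℝ³ be affinely independent, with vertical projections πᵢ ∈ ℝ² (first two coordinates) forming a convex quadrilateral in which the segment π₃π₄ is a diagonal: π₁ and π₂ lie strictly on opposite sides of the line through π₃ and π₄, and π₃ and π₄ lie strictly on opposite sides of the line through π₁ and π₂. Consider the five pairs E = {{1,3},{1,4},{2,3},{2,4},{3,4}} (the edges of the lower surface). Then: (existence) for every h₁, h₂, h₃, h₄ ∈ ℝ there exists u : {1,2,3,4} → ℝ³ with ⟨u(i) − u(j), vᵢ − vⱼ⟩ = 0 for every {i,j} ∈ E and ⟨u(i), e₃⟩ = hᵢ for every i; (uniqueness) if u and u' are two such maps, then there exist a skew-adjoint linear map A : ℝ³ → ℝ³ with A e₃ = 0 and b ∈ ℝ³ with ⟨b, e₃⟩ = 0 such that u'(i) = u(i) + A vᵢ + b for all i. -/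
open scoped RealInnerProductSpace

noncomputable section

/-- ℝ³ with its standard inner product. -/
abbrev E3 : Type := EuclideanSpace ℝ (Fin 3)

/-- The vertical direction `e₃ = (0,0,1)`. -/
def e3 : E3 := EuclideanSpace.single 2 1

/-- Vertical projection of a point of ℝ³ to ℝ² (its first two coordinates). -/
def vproj (x : E3) : ℝ × ℝ := (x 0, x 1)

/-- The 2×2 determinant of two plane vectors. -/
def det2 (a b : ℝ × ℝ) : ℝ := a.1 * b.2 - a.2 * b.1

/-- `u` is an infinitesimal flex of the lower surface `S₋` of the simplex `v₁v₂v₃v₄`: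
it preserves to first order the lengths of the five segments
`v₁v₃, v₁v₄, v₂v₃, v₂v₄, v₃v₄` (vertices indexed here by `0,1,2,3`). -/
def IsLowerFlex (v u : Fin 4 → E3) : Prop :=
  ⟪u 0 - u 2, v 0 - v 2⟫ = 0 ∧ ⟪u 0 - u 3, v 0 - v 3⟫ = 0 ∧
  ⟪u 1 - u 2, v 1 - v 2⟫ = 0 ∧ ⟪u 1 - u 3, v 1 - v 3⟫ = 0 ∧
  ⟪u 2 - u 3, v 2 - v 3⟫ = 0

theorem inner_eq_coord (x y : E3) : ⟪x, y⟫ = x 0 * y 0 + x 1 * y 1 + x 2 * y 2 := by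
  simp only [PiLp.inner_apply, Fin.sum_univ_three, RCLike.inner_apply, conj_trivial]
  ring

theorem inner_e3 (x : E3) : ⟪x, e3⟫ = x 2 := by
  simp [inner_eq_coord, e3]

/-- Two linear equations with nonzero determinant have a common solution. -/
theorem exists_dot_eq_of_det2_ne_zero {a b : ℝ × ℝ} (hab : det2 a b ≠ 0) (c d : ℝ) :
    ∃ x y : ℝ, x * a.1 + y * a.2 = c ∧ x * b.1 + y * b.2 = d := by
  refine ⟨(c * b.2 - d * a.2) / det2 a b, (d * a.1 - c * b.1) / det2 a b, ?_, ?_⟩ <;>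
    field_simp <;> simp only [det2] <;> ring

/-- A plane vector orthogonal to two linearly independent vectors vanishes. -/
theorem eq_zero_of_dot_eq_zero {a b : ℝ × ℝ} (hab : det2 a b ≠ 0) {x y : ℝ}
    (ha : x * a.1 + y * a.2 = 0) (hb : x * b.1 + y * b.2 = 0) : x = 0 ∧ y = 0 := by
  constructor <;> refine (mul_eq_zero.1 ?_).resolve_right hab <;> simp only [det2]
  · linear_combination b.2 * ha - a.2 * hb
  · linear_combination a.1 * hb - b.1 * ha

theorem det2_sub_sub_comm (x p q : ℝ × ℝ) :
    det2 (x - p) (q - p) = -det2 (x - p) (x - q) := by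
  simp only [det2, Prod.fst_sub, Prod.snd_sub]
  ring

/-- The infinitesimal rotation with vertical axis and angular velocity `s`. -/
def verticalRotation (s : ℝ) : E3 →ₗ[ℝ] E3 where
  toFun x := !₂[-(s * x 1), s * x 0, 0]
  map_add' x y := by
    ext i
    fin_cases i <;> simp <;> ring
  map_smul' c x := by
    ext i
    fin_cases i <;> simp <;> ring

theorem verticalRotation_apply (s : ℝ) (x : E3) :
    verticalRotation s x = !₂[-(s * x 1), s * x 0, 0] := rfl

theorem verticalRotation_skew (s : ℝ) (x y : E3) :
    ⟪verticalRotation s x, y⟫ = -⟪x, verticalRotation s y⟫ := by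
  simp [inner_eq_coord, verticalRotation_apply]
  ring

theorem verticalRotation_e3 (s : ℝ) : verticalRotation s e3 = 0 := by
  ext i
  fin_cases i <;> simp [verticalRotation_apply, e3]

/-- Given prescribed pairings with the sides `x - p` and `x - q` of a triangle with
non-degenerate projection, there is a vector of prescribed height realizing them. -/
theorem exists_inner_eq {p q x : E3}
    (hdet : det2 (vproj x - vproj p) (vproj q - vproj p) ≠ 0) (up uq : E3) (t : ℝ) :
    ∃ w : E3, ⟪w - up, x - p⟫ = 0 ∧ ⟪w - uq, x - q⟫ = 0 ∧ w 2 = t := by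
  rw [det2_sub_sub_comm, neg_ne_zero] at hdet
  obtain ⟨a, b, ha, hb⟩ := exists_dot_eq_of_det2_ne_zero hdet
    (⟪up, x - p⟫ - t * (x 2 - p 2)) (⟪uq, x - q⟫ - t * (x 2 - q 2))
  refine ⟨!₂[a, b, t], ?_, ?_, by simp⟩
  · simp [inner_eq_coord, vproj] at ha ⊢
    linear_combination ha
  · simp [inner_eq_coord, vproj] at hb ⊢
    linear_combination hb

/-- A horizontal displacement `d` of the apex `x` of a triangle, preserving to first order the
lengths of the two sides at `x`, extends the rotation given on the opposite side `p q`. -/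
theorem eq_verticalRotation_add {p q x b d : E3} {s : ℝ}
    (hdet : det2 (vproj x - vproj p) (vproj q - vproj p) ≠ 0) (hb : b 2 = 0) (hd : d 2 = 0)
    (hp : ⟪d - (verticalRotation s p + b), x - p⟫ = 0)
    (hq : ⟪d - (verticalRotation s q + b), x - q⟫ = 0) :
    d = verticalRotation s x + b := by
  rw [det2_sub_sub_comm, neg_ne_zero] at hdet
  simp [inner_eq_coord, verticalRotation_apply, hb, hd] at hp hq
  obtain ⟨h0, h1⟩ := eq_zero_of_dot_eq_zero hdet
    (x := d 0 - (-(s * x 1) + b 0)) (y := d 1 - (s * x 0 + b 1))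
    (by simp [vproj]; linear_combination hp) (by simp [vproj]; linear_combination hq)
  ext i
  fin_cases i
  · simpa [verticalRotation_apply] using sub_eq_zero.1 h0
  · simpa [verticalRotation_apply] using sub_eq_zero.1 h1
  · simp [verticalRotation_apply, hb, hd]

/-- A horizontal displacement of a segment with non-degenerate projection, preserving its length
to first order, is induced by a rotation with vertical axis and a horizontal translation. -/
theorem exists_verticalRotation {p q dp dq : E3}
    (hpq : (q 0 - p 0) ^ 2 + (q 1 - p 1) ^ 2 ≠ 0) (hp : dp 2 = 0) (hq : dq 2 = 0)
    (h : ⟪dp - dq, p - q⟫ = 0) :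
    ∃ (s : ℝ) (b : E3), b 2 = 0 ∧ dp = verticalRotation s p + b ∧
      dq = verticalRotation s q + b := by
  simp [inner_eq_coord, hp, hq] at h
  obtain ⟨s, hs⟩ : ∃ s, s * ((q 0 - p 0) ^ 2 + (q 1 - p 1) ^ 2) =
      (q 0 - p 0) * (dq 1 - dp 1) - (q 1 - p 1) * (dq 0 - dp 0) :=
    ⟨_, div_mul_cancel₀ _ hpq⟩
  refine ⟨s, dp - verticalRotation s p, by simp [verticalRotation_apply, hp], by abel, ?_⟩
  ext i
  fin_cases i
  · simp [verticalRotation_apply]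
    apply mul_left_cancel₀ hpq
    linear_combination (q 0 - p 0) * h + (q 1 - p 1) * hs
  · simp [verticalRotation_apply]
    apply mul_left_cancel₀ hpq
    linear_combination (q 1 - p 1) * h - (q 0 - p 0) * hs
  · simp [verticalRotation_apply, hp, hq]

/-- For a simplex `v₁v₂v₃v₄` (indexed `0,1,2,3`) projecting vertically onto a convex
quadrilateral with diagonal `π₃π₄`, any prescription of the vertical components at the
four vertices is realized by an infinitesimal flex of the lower surface, uniquely up to
horizontal translations and infinitesimal rotations with vertical axis. -/
theorem lower_surface_flexes (v : Fin 4 → E3) (hv : AffineIndependent ℝ v)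
    (hquad34 : det2 (vproj (v 0) - vproj (v 2)) (vproj (v 3) - vproj (v 2)) *
        det2 (vproj (v 1) - vproj (v 2)) (vproj (v 3) - vproj (v 2)) < 0)
    (hquad12 : det2 (vproj (v 2) - vproj (v 0)) (vproj (v 1) - vproj (v 0)) *
        det2 (vproj (v 3) - vproj (v 0)) (vproj (v 1) - vproj (v 0)) < 0)
    (h : Fin 4 → ℝ) :
    (∃ u : Fin 4 → E3, IsLowerFlex v u ∧ ∀ i : Fin 4, ⟪u i, e3⟫ = h i) ∧
    (∀ u u' : Fin 4 → E3,
      IsLowerFlex v u → (∀ i : Fin 4, ⟪u i, e3⟫ = h i) →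
      IsLowerFlex v u' → (∀ i : Fin 4, ⟪u' i, e3⟫ = h i) →
      ∃ (A : E3 →ₗ[ℝ] E3) (b : E3),
        (∀ x y : E3, ⟪A x, y⟫ = -⟪x, A y⟫) ∧ A e3 = 0 ∧ ⟪b, e3⟫ = 0 ∧
        ∀ i : Fin 4, u' i = u i + A (v i) + b) := by
  have hdet0 := left_ne_zero_of_mul hquad34.ne
  have hdet1 := right_ne_zero_of_mul hquad34.ne
  have hlen : (v 3 0 - v 2 0) ^ 2 + (v 3 1 - v 2 1) ^ 2 ≠ 0 := by
    intro h0
    have hx : v 3 0 - v 2 0 = 0 := by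
      nlinarith [sq_nonneg (v 3 0 - v 2 0), sq_nonneg (v 3 1 - v 2 1)]
    have hy : v 3 1 - v 2 1 = 0 := by
      nlinarith [sq_nonneg (v 3 0 - v 2 0), sq_nonneg (v 3 1 - v 2 1)]
    apply hdet0
    simp [det2, vproj, hx, hy]
  simp only [inner_e3]
  constructor
  · obtain ⟨t, ht⟩ : ∃ t, t * ((v 3 0 - v 2 0) ^ 2 + (v 3 1 - v 2 1) ^ 2) =
        -((h 3 - h 2) * (v 3 2 - v 2 2)) := ⟨_, div_mul_cancel₀ _ hlen⟩
    let u2 : E3 := !₂[0, 0, h 2]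
    let u3 : E3 := !₂[t * (v 3 0 - v 2 0), t * (v 3 1 - v 2 1), h 3]
    obtain ⟨u0, h02, h03, h0⟩ := exists_inner_eq hdet0 u2 u3 (h 0)
    obtain ⟨u1, h12, h13, h1⟩ := exists_inner_eq hdet1 u2 u3 (h 1)
    refine ⟨![u0, u1, u2, u3], ⟨h02, h03, h12, h13, ?_⟩, ?_⟩
    · simp [inner_eq_coord, u2, u3]
      linear_combination ht
    · intro i
      fin_cases i <;> simp [h0, h1, u2, u3]
  · rintro u u' ⟨f02, f03, f12, f13, f23⟩ hu ⟨g02, g03, g12, g13, g23⟩ hu'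
    have hd (i : Fin 4) : (u' i - u i) 2 = 0 := by simp [hu, hu']
    have flex {i j : Fin 4} (hf : ⟪u i - u j, v i - v j⟫ = 0)
        (hg : ⟪u' i - u' j, v i - v j⟫ = 0) :
        ⟪(u' i - u i) - (u' j - u j), v i - v j⟫ = 0 := by
      rw [sub_sub_sub_comm, inner_sub_left, hf, hg, sub_zero]
    obtain ⟨s, b, hb, h2, h3⟩ := exists_verticalRotation hlen (hd 2) (hd 3) (flex f23 g23)
    have h0 := eq_verticalRotation_add hdet0 hb (hd 0) (h2 ▸ flex f02 g02) (h3 ▸ flex f03 g03)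
    have h1 := eq_verticalRotation_add hdet1 hb (hd 1) (h2 ▸ flex f12 g12) (h3 ▸ flex f13 g13)
    refine ⟨verticalRotation s, b, verticalRotation_skew s, verticalRotation_e3 s, hb, ?_⟩
    intro i
    rw [add_assoc, ← sub_eq_iff_eq_add']
    fin_cases i
    exacts [h0, h1, h2, h3]
end
end

section
/- Let v : Fin 4 → ℝ³ be affinely independent and let u : Fin 4 → ℝ³ satisfy ⟨u(i) − u(j), v(i) − v(j)⟩ = 0 for all i, j. Then u is trivial: there exist a skew-adjoint linear map A : ℝ³ → ℝ³ and b ∈ ℝ³ such that u(i) = A(v(i)) + b for all i. (Every non-degenerate simplex in ℝ³ is infinitesimally rigid.) -/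
open scoped RealInnerProductSpace

noncomputable section

/-- Skew-adjointness of a linear map may be checked on a basis. -/
theorem inner_map_eq_neg_of_basis {ι E : Type*} [NormedAddCommGroup E] [InnerProductSpace ℝ E]
    (B : Module.Basis ι ℝ E) (A : E →ₗ[ℝ] E)
    (h : ∀ i j, ⟪A (B i), B j⟫ = -⟪B i, A (B j)⟫) (x y : E) : ⟪A x, y⟫ = -⟪x, A y⟫ := by
  have key : (innerₗ E).comp A = -(innerₗ E).compl₂ A :=
    B.ext fun i => B.ext fun j => by simpa using h i j
  simpa using LinearMap.congr_fun₂ key x y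

/-- An infinitesimal isometric deformation preserves to first order the inner products of the
edge vectors based at a vertex `k`. -/
theorem inner_sub_sub_eq_neg {ι E : Type*} [NormedAddCommGroup E] [InnerProductSpace ℝ E]
    {u v : ι → E} (hu : ∀ i j, ⟪u i - u j, v i - v j⟫ = 0) (i j k : ι) :
    ⟪u i - u k, v j - v k⟫ = -⟪v i - v k, u j - u k⟫ := by
  have hij := hu i j
  rw [← sub_sub_sub_cancel_right (u i) (u j) (u k), ← sub_sub_sub_cancel_right (v i) (v j) (v k),
    inner_sub_left, inner_sub_right _ (v i - v k), inner_sub_right _ (v i - v k), hu i k, hu j k,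
    real_inner_comm (v i - v k)] at hij
  linarith

/-- Every non-degenerate simplex in ℝ³ is infinitesimally rigid: if `v : Fin 4 → ℝ³` is
affinely independent and `u : Fin 4 → ℝ³` satisfies `⟨u i − u j, v i − v j⟩ = 0` for all
`i, j`, then `u` is the restriction of a Killing field `x ↦ A x + b` with `A` skew-adjoint. -/
theorem simplex_infinitesimally_rigid (v : Fin 4 → E3) (hv : AffineIndependent ℝ v)
    (u : Fin 4 → E3) (hu : ∀ i j : Fin 4, ⟪u i - u j, v i - v j⟫ = 0) :
    ∃ (A : E3 →ₗ[ℝ] E3) (b : E3),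
      (∀ x y : E3, ⟪A x, y⟫ = -⟪x, A y⟫) ∧ ∀ i : Fin 4, u i = A (v i) + b := by
  have hli := (affineIndependent_iff_linearIndependent_vsub ℝ v 0).1 hv
  have : Nonempty {i : Fin 4 // i ≠ 0} := ⟨⟨1, one_ne_zero⟩⟩
  let B := basisOfLinearIndependentOfCardEqFinrank hli (by simp)
  have hB (i : {i : Fin 4 // i ≠ 0}) : B i = v i - v 0 := by simp [B]
  let A : E3 →ₗ[ℝ] E3 := B.constr ℝ fun i => u i - u 0
  have hA (i : {i : Fin 4 // i ≠ 0}) : A (v i - v 0) = u i - u 0 := by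
    rw [← hB, B.constr_basis]
  refine ⟨A, u 0 - A (v 0), inner_map_eq_neg_of_basis B A fun i j => ?_, fun i => ?_⟩
  · rw [hB, hB, hA, hA]
    exact inner_sub_sub_eq_neg hu i j 0
  · by_cases hi : i = 0
    · simp [hi]
    · have := hA ⟨i, hi⟩
      rw [map_sub] at this
      rw [add_sub_left_comm, this, add_sub_cancel]
end
end

section
/- Let p, q, r, p', q', r' ∈ ℝ³ be such that ‖p − q‖ = ‖p' − q'‖, ‖q − r‖ = ‖q' − r'‖, ‖p − r‖ = ‖p' − r'‖, and the third coordinates satisfy p₃ = p'₃, q₃ = q'₃, r₃ = r'₃. Then there exists an isometry F of ℝ³ preserving the height function (the third coordinate of F(x) equals the third coordinate of x, for every x ∈ ℝ³) such that F(p) = p', F(q) = q', F(r) = r'. -/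
noncomputable section

/-- Two linear maps into a finite-dimensional inner product space with pointwise equal norms
differ by a linear isometry of the target. -/
theorem LinearMap.exists_linearIsometryEquiv_apply_eq {M V : Type*} [AddCommGroup M] [Module ℝ M]
    [NormedAddCommGroup V] [InnerProductSpace ℝ V] [FiniteDimensional ℝ V]
    (f g : M →ₗ[ℝ] V) (h : ∀ c, ‖f c‖ = ‖g c‖) :
    ∃ L : V ≃ₗᵢ[ℝ] V, ∀ c, L (f c) = g c := by
  obtain ⟨s, hs⟩ := f.rangeRestrict.exists_rightInverse_of_surjective f.range_rangeRestrict
  have hfs (x : f.range) : f (s x) = x := congrArg Subtype.val (LinearMap.congr_fun hs x)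
  let L₀ : f.range →ₗᵢ[ℝ] V :=
    { toLinearMap := g ∘ₗ s
      norm_map' := fun x => by simp [← h, hfs] }
  refine ⟨L₀.extend.toLinearIsometryEquiv rfl, fun c => ?_⟩
  have hsc : f (s (f.rangeRestrict c)) = f c := hfs _
  have hext : L₀.extend (f c) = g (s (f.rangeRestrict c)) := L₀.extend_apply (f.rangeRestrict c)
  rw [LinearIsometry.coe_toLinearIsometryEquiv, hext, ← sub_eq_zero, ← map_sub, ← norm_eq_zero,
    ← h, map_sub, hsc, sub_self, norm_zero]

/-- Families with the same Gram matrix are related by a linear isometry. -/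
theorem exists_linearIsometryEquiv_of_inner_eq {ι V : Type*} [Fintype ι]
    [NormedAddCommGroup V] [InnerProductSpace ℝ V] [FiniteDimensional ℝ V]
    (v w : ι → V) (h : ∀ i j, inner ℝ (v i) (v j) = inner ℝ (w i) (w j)) :
    ∃ L : V ≃ₗᵢ[ℝ] V, ∀ i, L (v i) = w i := by
  classical
  obtain ⟨L, hL⟩ := LinearMap.exists_linearIsometryEquiv_apply_eq
    (Fintype.linearCombination ℝ v) (Fintype.linearCombination ℝ w) fun c => by
      rw [← sq_eq_sq₀ (norm_nonneg _) (norm_nonneg _), ← real_inner_self_eq_norm_sq,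
        ← real_inner_self_eq_norm_sq]
      simp only [Fintype.linearCombination_apply, sum_inner, inner_sum, real_inner_smul_left,
        real_inner_smul_right, h]
  exact ⟨L, fun i => by simpa using hL (Pi.single i 1)⟩

/-- The inner product of two sides of a triangle at a common vertex depends only on the side
lengths. -/
theorem inner_sub_sub_eq_of_dist_eq {V : Type*} [NormedAddCommGroup V] [InnerProductSpace ℝ V]
    {p q r p' q' r' : V} (hpq : dist p q = dist p' q') (hqr : dist q r = dist q' r')
    (hpr : dist p r = dist p' r') :
    inner ℝ (q - p) (r - p) = inner ℝ (q' - p') (r' - p') := by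
  simp only [real_inner_eq_norm_mul_self_add_norm_mul_self_sub_norm_sub_mul_self_div_two,
    sub_sub_sub_cancel_right, ← dist_eq_norm, dist_comm q p, dist_comm q' p', dist_comm r p,
    dist_comm r' p', hpq, hqr, hpr]

/-- If two triples of points in ℝ³ have pairwise equal mutual distances and equal heights
(third coordinates), then some isometry of ℝ³ preserving the height function carries one
triple to the other.  (A prism is determined, among prisms with the same induced metric on
the upper face, by the heights of its vertical edges.) -/
theorem prism_determined_by_heights (p q r p' q' r' : E3)
    (hpq : dist p q = dist p' q') (hqr : dist q r = dist q' r')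
    (hpr : dist p r = dist p' r')
    (hp : p 2 = p' 2) (hq : q 2 = q' 2) (hr : r 2 = r' 2) :
    ∃ F : E3 ≃ᵢ E3, (∀ x : E3, F x 2 = x 2) ∧ F p = p' ∧ F q = q' ∧ F r = r' := by
  let e : E3 := EuclideanSpace.single 2 1
  have he (x : E3) : inner ℝ e x = x 2 := by simp [e, EuclideanSpace.inner_single_left]
  have he' (x : E3) : inner ℝ x e = x 2 := by rw [real_inner_comm, he]
  obtain ⟨L, hL⟩ := exists_linearIsometryEquiv_of_inner_eq ![q - p, r - p, e]
    ![q' - p', r' - p', e] fun i j => by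
      have hqq := inner_sub_sub_eq_of_dist_eq hpq (by simp) hpq
      have hrr := inner_sub_sub_eq_of_dist_eq hpr (by simp) hpr
      have hqr' := inner_sub_sub_eq_of_dist_eq hpq hqr hpr
      have hrq' := inner_sub_sub_eq_of_dist_eq hpr (by simpa only [dist_comm] using hqr) hpq
      fin_cases i <;> fin_cases j <;>
        simp only [Fin.zero_eta, Fin.mk_one, Fin.reduceFinMk, Matrix.cons_val, he, he',
          PiLp.sub_apply, hp, hq, hr, hqq, hrr, hqr', hrq']
  have hLq : L (q - p) = q' - p' := hL 0
  have hLr : L (r - p) = r' - p' := hL 1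
  have hLe : L e = e := hL 2
  refine ⟨(IsometryEquiv.subRight p).trans (L.toIsometryEquiv.trans (IsometryEquiv.addRight p')),
    fun x => ?_, ?_, ?_, ?_⟩
  · have hx : L (x - p) 2 = x 2 - p 2 := by
      rw [← he, ← PiLp.sub_apply, ← he (x - p), ← L.inner_map_map e (x - p), hLe]
    simp [-map_sub, hx, hp]
  · simp
  · simp [-map_sub, hLq]
  · simp [-map_sub, hLr]
end
end

section
/- Let p : Fin 3 → ℝ³ be affinely independent and let u : Fin 3 → ℝ³ satisfy ⟨u(i) − u(j), p(i) − p(j)⟩ = 0 for all i, j. Then there exist a skew-adjoint linear map A : ℝ³ → ℝ³ and b ∈ ℝ³ such that u(i) = A(p(i)) + b for all i. (Every first-order deformation of a non-degenerate triangle in ℝ³ preserving its edge lengths to first order is the restriction of a Killing field.) -/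
open scoped RealInnerProductSpace

noncomputable section

section SkewAdjoint

variable {V : Type*} [NormedAddCommGroup V] [InnerProductSpace ℝ V]

/-- The infinitesimal rotation `z ↦ ⟪x, z⟫ y - ⟪y, z⟫ x` in the plane of `x` and `y`. -/
def planeRotation (x y : V) : V →ₗ[ℝ] V :=
  (innerₛₗ ℝ x).smulRight y - (innerₛₗ ℝ y).smulRight x

theorem planeRotation_apply (x y z : V) :
    planeRotation x y z = ⟪x, z⟫ • y - ⟪y, z⟫ • x := by
  simp [planeRotation]

theorem inner_planeRotation_left (x y z w : V) :
    ⟪planeRotation x y z, w⟫ = -⟪z, planeRotation x y w⟫ := by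
  simp only [planeRotation_apply, inner_sub_left, inner_sub_right, real_inner_smul_left,
    real_inner_smul_right, real_inner_comm x z, real_inner_comm y z]
  ring

/-- Two orthogonal nonzero vectors `e`, `f` can be sent to `a`, `d` by a skew-adjoint map when
`a`, `d` satisfy the evident necessary conditions. -/
theorem exists_skewAdjoint_of_orthogonal {e f a d : V} (he : e ≠ 0) (hf : f ≠ 0)
    (hef : ⟪e, f⟫ = 0) (hae : ⟪a, e⟫ = 0) (hdf : ⟪d, f⟫ = 0) (h : ⟪a, f⟫ + ⟪d, e⟫ = 0) :
    ∃ A : V →ₗ[ℝ] V, (∀ x y, ⟪A x, y⟫ = -⟪x, A y⟫) ∧ A e = a ∧ A f = d := by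
  have he' : ⟪e, e⟫ ≠ 0 := inner_self_ne_zero.mpr he
  have hf' : ⟪f, f⟫ ≠ 0 := inner_self_ne_zero.mpr hf
  have hfe : ⟪f, e⟫ = 0 := by rw [real_inner_comm, hef]
  set g : V := d + (⟪a, f⟫ / ⟪e, e⟫) • e with hg
  have hge : ⟪g, e⟫ = 0 := by
    rw [hg, inner_add_left, real_inner_smul_left, div_mul_cancel₀ _ he']
    linarith
  have hgf : ⟪g, f⟫ = 0 := by
    rw [hg, inner_add_left, real_inner_smul_left, hef, hdf, mul_zero, add_zero]
  refine ⟨⟪e, e⟫⁻¹ • planeRotation e a + ⟪f, f⟫⁻¹ • planeRotation f g, fun x y => ?_, ?_, ?_⟩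
  · simp only [LinearMap.add_apply, LinearMap.smul_apply, inner_add_left, inner_add_right,
      real_inner_smul_left, real_inner_smul_right, inner_planeRotation_left]
    ring
  · simp only [LinearMap.add_apply, LinearMap.smul_apply, planeRotation_apply, hae, hfe, hge,
      zero_smul, sub_zero, smul_zero, add_zero, inv_smul_smul₀ he']
  · simp only [LinearMap.add_apply, LinearMap.smul_apply, planeRotation_apply, hef, hgf,
      zero_smul, sub_zero, zero_sub, inv_smul_smul₀ hf']
    rw [hg]
    module

/-- Two linearly independent vectors `v`, `w` can be sent to `a`, `c` by a skew-adjoint map when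
`a`, `c` satisfy the evident necessary conditions. -/
theorem LinearIndependent.exists_skewAdjoint {v w a c : V}
    (hvw : LinearIndependent ℝ ![v, w]) (hav : ⟪a, v⟫ = 0) (hcw : ⟪c, w⟫ = 0)
    (h : ⟪a, w⟫ + ⟪c, v⟫ = 0) :
    ∃ A : V →ₗ[ℝ] V, (∀ x y, ⟪A x, y⟫ = -⟪x, A y⟫) ∧ A v = a ∧ A w = c := by
  have hv : v ≠ 0 := hvw.ne_zero 0
  set t : ℝ := ⟪v, w⟫ / ⟪v, v⟫ with ht
  have hf : w - t • v ≠ 0 := fun h0 =>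
    (LinearIndependent.pair_iff' hv).mp hvw t (sub_eq_zero.mp h0).symm
  have hvf : ⟪v, w - t • v⟫ = 0 := by
    rw [inner_sub_right, real_inner_smul_right, ht,
      div_mul_cancel₀ _ (inner_self_ne_zero.mpr hv), sub_self]
  obtain ⟨A, hA, hAv, hAf⟩ := exists_skewAdjoint_of_orthogonal (a := a) (d := c - t • a)
    hv hf hvf hav
    (by
      simp only [inner_sub_left, inner_sub_right, real_inner_smul_left, real_inner_smul_right,
        hav, hcw]
      linear_combination -t * h)
    (by
      simp only [inner_sub_left, inner_sub_right, real_inner_smul_left, real_inner_smul_right,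
        hav]
      linear_combination h)
  refine ⟨A, hA, hAv, ?_⟩
  rw [map_sub, map_smul, hAv] at hAf
  exact sub_left_injective hAf

end SkewAdjoint

/-- Every first-order deformation of a non-degenerate triangle in ℝ³ preserving its edge
lengths to first order is the restriction of a Killing field: if `p : Fin 3 → ℝ³` is
affinely independent and `u : Fin 3 → ℝ³` satisfies `⟨u i − u j, p i − p j⟩ = 0` for all
`i, j`, then `u i = A (p i) + b` with `A` skew-adjoint linear and `b ∈ ℝ³`. -/
theorem triangle_deformation_is_killing (p : Fin 3 → E3) (hp : AffineIndependent ℝ p)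
    (u : Fin 3 → E3) (hu : ∀ i j : Fin 3, ⟪u i - u j, p i - p j⟫ = 0) :
    ∃ (A : E3 →ₗ[ℝ] E3) (b : E3),
      (∀ x y : E3, ⟪A x, y⟫ = -⟪x, A y⟫) ∧ ∀ i : Fin 3, u i = A (p i) + b := by
  have hvw : LinearIndependent ℝ ![p 1 - p 0, p 2 - p 0] := by
    have hli := (affineIndependent_iff_linearIndependent_vsub ℝ p 0).mp hp
    have hcomp := hli.comp ![⟨1, by decide⟩, ⟨2, by decide⟩] (by
      intro i j; fin_cases i <;> fin_cases j <;> simp)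
    have heq : ![p 1 - p 0, p 2 - p 0] =
        (fun i : {i : Fin 3 // i ≠ 0} => p i -ᵥ p 0) ∘ ![⟨1, by decide⟩, ⟨2, by decide⟩] := by
      ext i : 1
      fin_cases i <;> rfl
    rw [heq]
    exact hcomp
  have h12 : ⟪u 1 - u 0, p 2 - p 0⟫ + ⟪u 2 - u 0, p 1 - p 0⟫ = 0 := by
    have h10 := hu 1 0
    have h20 := hu 2 0
    have h21 := hu 2 1
    simp only [inner_sub_left, inner_sub_right] at h10 h20 h21 ⊢
    linarith
  obtain ⟨A, hA, hA1, hA2⟩ := hvw.exists_skewAdjoint (hu 1 0) (hu 2 0) h12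
  refine ⟨A, u 0 - A (p 0), hA, fun i => ?_⟩
  rw [map_sub] at hA1 hA2
  fin_cases i
  · simp
  · change u 1 = A (p 1) + (u 0 - A (p 0))
    rw [← sub_add_cancel (u 1) (u 0), ← hA1]
    abel
  · change u 2 = A (p 2) + (u 0 - A (p 0))
    rw [← sub_add_cancel (u 2) (u 0), ← hA2]
    abel
end
end
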